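/- arXiv:1004.1633 — 3 statements merged into one kernel-verified Lean document; each statement's English description precedes it below -/
import Mathlib

section
/- Reciprocity for generalized quadratic Gauss sums: if p, m are positive integers and n is an integer with mp + n even, then (1/√p)·∑_{j=0}^{p-1} exp(πi(j²m + jn)/p) = exp(πi(mp − n²)/(4mp))·(1/√m)·∑_{j=0}^{m-1} exp(−πi(j²p + jn)/m). -/
open Finset
open Complex Filter Topology


noncomputable def gth (A b : ℂ) : ℂ :=
  ∑' l : ℤ, cexp (-Real.pi * A * l ^ 2 + 2 * Real.pi * b * l)

lemma gsummable {A : ℂ} (hA : 0 < A.re) (b : ℂ) :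
    Summable fun l : ℤ => cexp (-Real.pi * A * l ^ 2 + 2 * Real.pi * b * l) := by
  have h := (summable_jacobiTheta₂_term_iff (-I * b) (I * A)).mpr (by simpa using hA)
  refine h.congr fun l => ?_
  rw [jacobiTheta₂_term]
  congr 1
  linear_combination (-2 * Real.pi * l * b + Real.pi * l ^ 2 * A) * I_sq

lemma gsummable' {D : ℂ} (hD : 0 < D.re) (x : ℂ) :
    Summable fun l : ℤ => cexp (-Real.pi * D * (l + x) ^ 2) := by
  have h := (gsummable hD (-D * x)).mul_left (cexp (-Real.pi * D * x ^ 2))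
  refine h.congr fun l => ?_
  rw [← Complex.exp_add]
  congr 1
  ring

lemma gth_tendsto (A : ℝ → ℂ) (hA : Tendsto (fun t => (A t).re) atTop atTop) (b : ℂ)
    (hb : b.re = 0) : Tendsto (fun t => gth (A t) b) atTop (𝓝 1) := by
  have h1 : (1 : ℂ) = ∑' l : ℤ, if l = 0 then (1 : ℂ) else 0 := by simp
  have hn : ∀ (t : ℝ) (l : ℤ), ‖cexp (-Real.pi * A t * l ^ 2 + 2 * Real.pi * b * l)‖
      = Real.exp (-Real.pi * (A t).re * l ^ 2) := by
    intro t l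
    rw [Complex.norm_exp]
    congr 1
    have : (-Real.pi * A t * l ^ 2 + 2 * Real.pi * b * l : ℂ)
      = ((-Real.pi * l ^ 2 : ℝ) : ℂ) * A t + ((2 * Real.pi * l : ℝ) : ℂ) * b := by
      push_cast; ring
    rw [this, add_re, re_ofReal_mul, re_ofReal_mul, hb]
    ring
  rw [h1]
  unfold gth
  refine tendsto_tsum_of_dominated_convergence
    (bound := fun l : ℤ => Real.exp (-Real.pi * 1 * l ^ 2)) ?_ ?_ ?_
  · have := (gsummable (A := 1) (by simp) 0).norm
    refine this.congr fun l => ?_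
    rw [Complex.norm_exp]
    congr 1
    have : (-Real.pi * 1 * l ^ 2 + 2 * Real.pi * 0 * l : ℂ)
      = ((-Real.pi * 1 * l ^ 2 : ℝ) : ℂ) := by push_cast; ring
    rw [this, ofReal_re]
  · intro l
    split_ifs with hl
    · simp [hl]
    · rw [tendsto_zero_iff_norm_tendsto_zero]
      simp_rw [hn]
      refine Real.tendsto_exp_atBot.comp ?_
      have hl2 : (0 : ℝ) < l ^ 2 := by positivity
      have : Tendsto (fun t => (-Real.pi * (l:ℝ)^2) * (A t).re) atTop atBot := by
        refine hA.const_mul_atTop_of_neg ?_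
        have := Real.pi_pos
        nlinarith [mul_pos this hl2]
      refine this.congr fun t => by ring
  · filter_upwards [hA.eventually_ge_atTop 1] with t ht l
    rw [hn]
    apply Real.exp_le_exp.mpr
    have := mul_nonneg Real.pi_pos.le (sq_nonneg (l : ℝ))
    nlinarith [mul_nonneg this (sub_nonneg.mpr ht)]

lemma gsplit (N : ℕ) (hN : 0 < N) (c : ℤ → ℂ) (hc : ∀ k, ‖c k‖ = 1)
    (hper : ∀ l j : ℤ, c (l * N + j) = c j) {A D : ℂ} (hA : 0 < A.re) (hD : 0 < D.re)
    (hAD : A * (N ^ 2 * D) = 1) (x : ℂ) :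
    ∑' k : ℤ, c k * cexp (-Real.pi * D * (k + x) ^ 2)
      = A ^ (1 / 2 : ℂ) * ∑ j ∈ range N, c j * gth A (-I * (j + x) / N) := by
  have : NeZero N := ⟨hN.ne'⟩
  have hN0 : (N : ℂ) ≠ 0 := by exact_mod_cast hN.ne'
  have hA0 : A ≠ 0 := by rintro rfl; simp at hA
  have hs : Summable fun k : ℤ => c k * cexp (-Real.pi * D * (k + x) ^ 2) := by
    refine Summable.of_norm ((gsummable' hD x).norm.congr fun k => ?_)
    rw [norm_mul, hc, one_mul]
  rw [← (Int.divModEquiv N).symm.tsum_eq]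
  have hs2 := (Int.divModEquiv N).symm.summable_iff.mpr hs
  rw [← (Equiv.prodComm _ _).tsum_eq]
  have hs3 := (Equiv.prodComm _ _).summable_iff.mpr hs2
  have := hs3.tsum_prod
  simp only [Function.comp_def, Equiv.prodComm_apply] at this
  simp only [Equiv.prodComm_apply]
  rw [this, tsum_fintype, mul_sum, ← Fin.sum_univ_eq_sum_range
    (fun j : ℕ => A ^ (1 / 2 : ℂ) * (c j * gth A (-I * (j + x) / N)))]
  refine Finset.sum_congr rfl fun j _ => ?_
  simp only [Prod.swap_prod_mk, Int.divModEquiv_symm_apply, hper]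
  rw [tsum_mul_left, gth, Complex.tsum_exp_neg_quadratic hA]
  have h2 : A ^ (1 / 2 : ℂ) ≠ 0 := by simp [cpow_eq_zero_iff, hA0]
  have h3 : ∀ l : ℤ, cexp (-Real.pi * D * (((l * N + (j : ℕ) : ℤ) : ℂ) + x) ^ 2)
      = cexp (-Real.pi / A * (l + I * (-I * ((j : ℕ) + x) / N)) ^ 2) := by
    intro l
    congr 1
    have : D = 1 / (A * N ^ 2) := by field_simp; linear_combination hAD
    have h4 : I * (-I * ((j : ℕ) + x) / N) = ((j : ℕ) + x) / N := by
      linear_combination (-((j : ℕ) + x) / N) * I_sq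
    rw [this, h4]
    push_cast
    field_simp
    ring
  simp_rw [h3]
  rw [mul_left_comm, ← mul_assoc (A ^ (1 / 2 : ℂ)), mul_one_div_cancel h2, one_mul]

lemma gcpow (r : ℝ) (hr : 0 < r) (z : ℂ) (hz : z ≠ 0) :
    ((r : ℂ) * z) ^ (1 / 2 : ℂ) = (Real.sqrt r : ℂ) * z ^ (1 / 2 : ℂ) := by
  rw [cpow_def_of_ne_zero (by simp [hr.ne', hz]), cpow_def_of_ne_zero hz,
    Complex.log_ofReal_mul hr hz, add_mul, Complex.exp_add]
  congr 1
  rw [Real.sqrt_eq_rpow, Real.rpow_def_of_pos hr]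
  push_cast
  rfl

noncomputable def ge (p m : ℕ) (n : ℤ) (k : ℤ) : ℂ :=
  cexp (Real.pi * I * ((k : ℂ) ^ 2 * m + k * n) / p)

lemma ge_norm (p m : ℕ) (n k : ℤ) : ‖ge p m n k‖ = 1 := by
  rw [ge, ← Complex.norm_exp_ofReal_mul_I (Real.pi * ((k : ℝ) ^ 2 * m + k * n) / p)]
  congr 2
  push_cast
  ring

lemma ge_per (p m : ℕ) (hp : 0 < p) (n : ℤ) (hpar : Even ((m : ℤ) * (p : ℤ) + n)) (l j : ℤ) :
    ge p m n (l * p + j) = ge p m n j := by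
  obtain ⟨r, hr⟩ := hpar
  obtain ⟨s, hs⟩ := Int.even_mul_pred_self l
  have hp0 : (p : ℂ) ≠ 0 := by exact_mod_cast hp.ne'
  have hr' : (m : ℂ) * p + n = r + r := by exact_mod_cast hr
  have hs' : (l : ℂ) * (l - 1) = s + s := by exact_mod_cast hs
  rw [ge, ge, Complex.exp_eq_exp_iff_exists_int]
  refine ⟨s * p * m + r * l + l * j * m, ?_⟩
  push_cast
  field_simp
  linear_combination (p : ℂ) * l * hr' + (p : ℂ) ^ 2 * m * hs'

lemma gkey (p m : ℕ) (hp : 0 < p) (hm : 0 < m) (n : ℤ)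
    (hpar : Even ((m : ℤ) * (p : ℤ) + n)) (T : ℝ) (hT : 0 < T) :
    (1 / (p ^ 2 * T) - I * m / p : ℂ) ^ (1 / 2 : ℂ) *
      ∑ j ∈ range p, ge p m n j * gth T (-I * (j + 0) / p)
     = cexp (-Real.pi * I * n ^ 2 / (4 * m * p)) * (1 + I / (p * m * T)) ^ (1 / 2 : ℂ) *
      ∑ j ∈ range m, (ge m p n j)⁻¹ * gth (T + I / (p * m)) (-I * (j + n / (2 * p)) / m) := by
  have hp0 : (p : ℂ) ≠ 0 := by exact_mod_cast hp.ne'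
  have hm0 : (m : ℂ) ≠ 0 := by exact_mod_cast hm.ne'
  have hT0 : (T : ℂ) ≠ 0 := by exact_mod_cast hT.ne'
  have hpR : (0 : ℝ) < p := by exact_mod_cast hp
  have hmR : (0 : ℝ) < m := by exact_mod_cast hm
  have hD1 : 0 < (1 / (p ^ 2 * T) : ℂ).re := by
    have : (1 / (p ^ 2 * T) : ℂ) = ((1 / (p ^ 2 * T) : ℝ) : ℂ) := by push_cast; rfl
    rw [this, ofReal_re]; positivity
  set a : ℂ := 1 / (p ^ 2 * T) - I * m / p with ha
  have har : 0 < a.re := by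
    have h : (I * m / p : ℂ) = ((m / p : ℝ) : ℂ) * I := by push_cast; ring
    rw [ha, sub_re, h, re_ofReal_mul, I_re]
    simpa using hD1
  have ha0 : a ≠ 0 := by intro h; simp [h] at har
  set A : ℂ := T + I / (p * m) with hAdef
  have hAT : A = (T : ℂ) * (1 + I / (p * m * T)) := by rw [hAdef]; field_simp
  have hAre : A.re = T := by
    have h : (I / (p * m) : ℂ) = ((1 / (p * m) : ℝ) : ℂ) * I := by push_cast; ring
    rw [hAdef, add_re, h, re_ofReal_mul, I_re, ofReal_re]; ring
  have hAr : 0 < A.re := by rw [hAre]; exact hT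
  have hA0 : A ≠ 0 := by intro h; simp [h] at hAr
  set D : ℂ := 1 / (m ^ 2 * A) with hD
  have hDr : 0 < D.re := by
    have h : D = ((1 / m ^ 2 : ℝ) : ℂ) * A⁻¹ := by rw [hD]; push_cast; field_simp
    rw [h, re_ofReal_mul, inv_re]
    have := normSq_pos.mpr hA0
    positivity
  have haD : 1 / a = I * p / m + D := by
    have h1 : I * p * m * A + 1 = I * p * m * T := by
      rw [hAdef]; field_simp; linear_combination I_sq
    have h2 : a * (I * p * m * T) = m ^ 2 * A := by
      rw [ha, hAdef]; field_simp; linear_combination (-(m : ℂ) * p * T) * I_sq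
    rw [← h1] at h2
    rw [hD, div_eq_iff ha0]
    field_simp
    linear_combination -h2
  have e1 := gsplit p hp (ge p m n) (ge_norm p m n) (ge_per p m hp n hpar)
    (A := T) (D := 1 / (p ^ 2 * T)) (by simpa using hT) hD1 (by field_simp) 0
  have hpar' : Even ((p : ℤ) * (m : ℤ) + n) := by rwa [mul_comm]
  have e2 := gsplit m hm (fun k => (ge m p n k)⁻¹) (fun k => by rw [norm_inv, ge_norm, inv_one])
    (fun l j => by rw [ge_per m p hm n hpar']) hAr hDr (by rw [hD]; field_simp) (n / (2 * p))
  have e3 := Complex.tsum_exp_neg_quadratic har (I * n / (2 * p))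
  have l1 : ∀ k : ℤ, cexp (-Real.pi * a * k ^ 2 + 2 * Real.pi * (I * n / (2 * p)) * k)
      = ge p m n k * cexp (-Real.pi * (1 / (p ^ 2 * T)) * (k + 0) ^ 2) := by
    intro k
    rw [ge, ← Complex.exp_add, ha]
    congr 1
    field_simp
    ring
  have l2 : ∀ k : ℤ, cexp (-Real.pi / a * (((-k : ℤ) : ℂ) + I * (I * n / (2 * p))) ^ 2)
      = cexp (-Real.pi * I * n ^ 2 / (4 * m * p)) *
        ((ge m p n k)⁻¹ * cexp (-Real.pi * D * (k + n / (2 * p)) ^ 2)) := by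
    intro k
    rw [ge, ← Complex.exp_neg, ← Complex.exp_add, ← Complex.exp_add]
    congr 1
    have h4 : I * (I * n / (2 * p)) = - (n / (2 * p) : ℂ) := by
      linear_combination (n / (2 * p) : ℂ) * I_sq
    have h5 : -Real.pi / a = -Real.pi * (I * p / m + D) := by rw [← haD]; ring
    rw [h4, h5]
    push_cast
    field_simp
    ring
  simp_rw [l1] at e3
  rw [← (Equiv.neg ℤ).tsum_eq (fun n_1 : ℤ => cexp (-Real.pi / a * (n_1 + I * (I * n / (2 * p))) ^ 2))] at e3
  simp only [Equiv.neg_apply] at e3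
  simp_rw [l2] at e3
  rw [tsum_mul_left, e1, e2] at e3
  have hz : (1 + I / (p * m * T) : ℂ) ≠ 0 := by
    intro h; rw [h] at hAT; simp [hAT] at hA0
  have s1 := gcpow T hT 1 one_ne_zero
  have s2 := gcpow T hT _ hz
  rw [mul_one, one_cpow, mul_one] at s1
  rw [← hAT] at s2
  rw [s1, s2] at e3
  have hsq : (Real.sqrt T : ℂ) ≠ 0 := by
    exact_mod_cast (Real.sqrt_pos.mpr hT).ne'
  have hac : a ^ (1 / 2 : ℂ) ≠ 0 := by simp [cpow_eq_zero_iff, ha0]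
  apply mul_left_cancel₀ hsq
  generalize a ^ (1 / 2 : ℂ) = w at *
  generalize (1 + I / (p * m * T) : ℂ) ^ (1 / 2 : ℂ) = w2 at *
  calc _ = w * (Real.sqrt T * ∑ j ∈ range p, ge p m n j * gth T (-I * (j + 0) / p)) := by ring
    _ = _ := by
      rw [e3, ← mul_assoc, mul_one_div_cancel hac]
      ring

theorem stmt3 (p m : ℕ) (hp : 0 < p) (hm : 0 < m) (n : ℤ)
    (hpar : Even ((m : ℤ) * (p : ℤ) + n)) :
    (1 / (Real.sqrt p : ℂ)) * ∑ j ∈ Finset.range p,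
        Complex.exp (Real.pi * Complex.I * ((j : ℂ) ^ 2 * (m : ℂ) + (j : ℂ) * (n : ℂ)) / p)
      = Complex.exp (Real.pi * Complex.I * ((m : ℂ) * (p : ℂ) - (n : ℂ) ^ 2) / (4 * m * p)) *
          ((1 / (Real.sqrt m : ℂ)) * ∑ j ∈ Finset.range m,
            Complex.exp (-(Real.pi : ℂ) * Complex.I *
              ((j : ℂ) ^ 2 * (p : ℂ) + (j : ℂ) * (n : ℂ)) / m)) := by
  have hp0 : (p : ℂ) ≠ 0 := by exact_mod_cast hp.ne'
  have hm0 : (m : ℂ) ≠ 0 := by exact_mod_cast hm.ne'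
  have hpR : (0 : ℝ) < p := by exact_mod_cast hp
  have hmR : (0 : ℝ) < m := by exact_mod_cast hm
  have hinv : Tendsto (fun T : ℝ => (T : ℂ)⁻¹) atTop (𝓝 0) := by
    have := (Complex.continuous_ofReal.tendsto 0).comp tendsto_inv_atTop_zero
    simpa [Function.comp_def] using this
  have t1 : Tendsto (fun T : ℝ => (1 / (p ^ 2 * T) - I * m / p : ℂ) ^ (1 / 2 : ℂ)) atTop
      (𝓝 ((((m / p : ℝ) : ℂ) * (-I)) ^ (1 / 2 : ℂ))) := by
    refine (continuousAt_cpow_const ?_).tendsto.comp ?_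
    · right
      rw [im_ofReal_mul]
      simp [hp.ne', hm.ne']
    · have := (hinv.const_mul (1 / p ^ 2 : ℂ)).sub_const (I * m / p)
      refine (this.congr fun T => ?_).trans_eq ?_
      · field_simp
      · congr 1; push_cast; ring
  have t2 : Tendsto (fun T : ℝ => (1 + I / (p * m * T) : ℂ) ^ (1 / 2 : ℂ)) atTop (𝓝 1) := by
    have h : Tendsto (fun T : ℝ => (1 + I / (p * m * T) : ℂ)) atTop (𝓝 1) := by
      have := (hinv.const_mul (I / (p * m) : ℂ)).const_add 1
      rw [mul_zero, add_zero] at this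
      refine this.congr fun T => ?_
      field_simp
    have := (continuousAt_cpow_const (b := (1 / 2 : ℂ)) one_mem_slitPlane).tendsto.comp h
    simpa [Function.comp_def] using this
  have t3 : Tendsto (fun T : ℝ => ∑ j ∈ range p, ge p m n j * gth T (-I * (j + 0) / p)) atTop
      (𝓝 (∑ j ∈ range p, ge p m n j * 1)) := by
    refine tendsto_finsetSum _ fun j _ => (gth_tendsto (fun T => T) ?_ _ ?_).const_mul _
    · exact tendsto_id.congr fun T => (ofReal_re T).symm
    · have : (-I * (j + 0) / p : ℂ) = ((-j / p : ℝ) : ℂ) * I := by push_cast; ring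
      rw [this, re_ofReal_mul, I_re, mul_zero]
  have t4 : Tendsto (fun T : ℝ => ∑ j ∈ range m, (ge m p n j)⁻¹ *
      gth (T + I / (p * m)) (-I * (j + n / (2 * p)) / m)) atTop
      (𝓝 (∑ j ∈ range m, (ge m p n j)⁻¹ * 1)) := by
    refine tendsto_finsetSum _ fun j _ =>
      (gth_tendsto (fun T => T + I / (p * m)) ?_ _ ?_).const_mul _
    · refine tendsto_id.congr fun T => ?_
      have h : (I / (p * m) : ℂ) = ((1 / (p * m) : ℝ) : ℂ) * I := by push_cast; ring
      rw [add_re, h, re_ofReal_mul, I_re, ofReal_re]; simp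
    · have : (-I * (j + n / (2 * p)) / m : ℂ) = ((-(j + n / (2 * p)) / m : ℝ) : ℂ) * I := by
        push_cast; ring
      rw [this, re_ofReal_mul, I_re, mul_zero]
  have key := tendsto_nhds_unique_of_eventuallyEq (t1.mul t3)
    ((t2.const_mul (cexp (-Real.pi * I * n ^ 2 / (4 * m * p)))).mul t4)
    (by filter_upwards [eventually_gt_atTop 0] with T hT using gkey p m hp hm n hpar T hT)
  rw [gcpow _ (by positivity) _ (by simp), cpow_def_of_ne_zero (by simp), log_neg_I,
    Real.sqrt_div' _ hpR.le] at key
  simp only [mul_one] at key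
  have c1 : ∑ j ∈ Finset.range p,
        Complex.exp (Real.pi * Complex.I * ((j : ℂ) ^ 2 * (m : ℂ) + (j : ℂ) * (n : ℂ)) / p)
      = ∑ j ∈ range p, ge p m n j := by
    simp [ge]
  have c2 : ∑ j ∈ Finset.range m, Complex.exp (-(Real.pi : ℂ) * Complex.I *
              ((j : ℂ) ^ 2 * (p : ℂ) + (j : ℂ) * (n : ℂ)) / m)
      = ∑ j ∈ range m, (ge m p n j)⁻¹ := by
    refine Finset.sum_congr rfl fun j _ => ?_
    rw [ge, ← Complex.exp_neg]
    congr 1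
    push_cast
    ring
  have c3 : cexp (Real.pi * I * ((m : ℂ) * (p : ℂ) - (n : ℂ) ^ 2) / (4 * m * p))
      = cexp (-Real.pi * I * n ^ 2 / (4 * m * p)) * (cexp (-(Real.pi / 2) * I * (1 / 2)))⁻¹ := by
    rw [← Complex.exp_neg, ← Complex.exp_add]
    congr 1
    field_simp
    ring
  rw [c1, c2, c3]
  have hsp : (Real.sqrt p : ℂ) ≠ 0 := by exact_mod_cast (Real.sqrt_pos.mpr hpR).ne'
  have hsm : (Real.sqrt m : ℂ) ≠ 0 := by exact_mod_cast (Real.sqrt_pos.mpr hmR).ne'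
  have hex := Complex.exp_ne_zero (-(Real.pi / 2) * I * (1 / 2))
  push_cast at key
  generalize cexp (-(Real.pi / 2) * I * (1 / 2)) = w at *
  generalize cexp (-Real.pi * I * n ^ 2 / (4 * m * p)) = w2 at *
  generalize ∑ j ∈ range p, ge p m n j = X at *
  generalize ∑ j ∈ range m, (ge m p n j)⁻¹ = Y at *
  field_simp at key ⊢
  linear_combination key
end

section
/- Landsberg–Schaar relation: for positive integers p and m, (1/√p)·∑_{j=0}^{p-1} exp(2πi·j²m/p) = (e^{πi/4}/√(2m))·∑_{j=0}^{2m-1} exp(−πi·j²p/(2m)). -/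
open Finset

lemma aux_summable {w : ℂ} (hw : 0 < w.re) :
    Summable (fun n : ℤ => ‖Complex.exp (-Real.pi * w * (n : ℂ) ^ 2)‖) := by
  have h := (summable_jacobiTheta₂_term_iff 0 (Complex.I * w)).mpr (by simpa using hw)
  refine h.norm.congr fun n => ?_
  unfold jacobiTheta₂_term
  congr 2
  linear_combination ((Real.pi : ℂ) * n ^ 2 * w) * Complex.I_sq

lemma aux_identity (N : ℕ) (hN : 0 < N) (f : ℤ → ℂ) (hf : ∀ n, ‖f n‖ ≤ 1)
    (hper : ∀ k r : ℤ, f (k * N + r) = f r) {A : ℂ} (hA : 0 < A.re) :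
    1 / A ^ (1 / 2 : ℂ) * ∑' n : ℤ, f n * Complex.exp (-Real.pi * (1 / (N ^ 2 * A)) * (n : ℂ) ^ 2)
      = ∑ r ∈ range N, f r *
        ∑' n : ℤ, Complex.exp (-Real.pi * A * (n : ℂ) ^ 2
          + 2 * Real.pi * (-Complex.I * r / N) * n) := by
  have : NeZero N := ⟨hN.ne'⟩
  have hN0 : (N : ℂ) ≠ 0 := by exact_mod_cast hN.ne'
  have hA0 : A ≠ 0 := by rintro rfl; simp at hA
  have hw : 0 < (1 / ((N : ℂ) ^ 2 * A)).re := by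
    have h1 : 0 < ((N : ℂ) ^ 2 * A).re := by
      have : ((N : ℂ) ^ 2 * A) = ((N ^ 2 : ℝ) : ℂ) * A := by push_cast; rfl
      rw [this, Complex.re_ofReal_mul]; positivity
    rw [one_div, Complex.inv_re]
    refine div_pos h1 (Complex.normSq_pos.mpr ?_)
    positivity
  set w := 1 / ((N : ℂ) ^ 2 * A) with hwdef
  have hs : Summable (fun n : ℤ => f n * Complex.exp (-Real.pi * w * (n : ℂ) ^ 2)) := by
    refine (aux_summable hw).of_norm_bounded fun n => ?_
    rw [norm_mul]
    exact mul_le_of_le_one_left (norm_nonneg _) (hf n)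
  have hs2 := (Int.divModEquiv N).symm.summable_iff.mpr hs
  have hs3 := (Equiv.prodComm (Fin N) ℤ).summable_iff.mpr hs2
  rw [← (Int.divModEquiv N).symm.tsum_eq, ← (Equiv.prodComm (Fin N) ℤ).tsum_eq]
  have := hs3.tsum_prod (γ := ℤ)
  simp only [Function.comp_def] at this
  rw [this, tsum_fintype, Finset.mul_sum, ← Fin.sum_univ_eq_sum_range (fun r => f r *
        ∑' n : ℤ, Complex.exp (-Real.pi * A * (n : ℂ) ^ 2
          + 2 * Real.pi * (-Complex.I * r / N) * n))]
  refine Finset.sum_congr rfl fun r _ => ?_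
  rw [Complex.tsum_exp_neg_quadratic hA, mul_left_comm (f _),
    ← tsum_mul_left (a := f _) (L := SummationFilter.unconditional ℤ)]
  congr 1
  refine tsum_congr fun k => ?_
  simp only [Equiv.prodComm_apply, Prod.swap, Int.divModEquiv, Equiv.coe_fn_symm_mk]
  rw [hper]
  congr 2
  push_cast
  rw [hwdef]
  have : Complex.I * (-Complex.I * (r : ℕ) / N) = ((r : ℕ) : ℂ) / N := by
    linear_combination (-((r : ℕ) : ℂ) / N) * Complex.I_sq
  rw [this]
  field_simp

lemma aux_tendsto (N : ℕ) (f : ℤ → ℂ) (A : ℝ → ℂ)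
    (hA : Filter.Tendsto (fun x => (A x).re) Filter.atTop Filter.atTop) :
    Filter.Tendsto (fun x => ∑ r ∈ range N, f r *
        ∑' n : ℤ, Complex.exp (-Real.pi * A x * (n : ℂ) ^ 2
          + 2 * Real.pi * (-Complex.I * r / N) * n)) Filter.atTop
      (nhds (∑ r ∈ range N, f r)) := by
  have hnorm : ∀ (x : ℝ) (r : ℕ) (n : ℤ), ‖Complex.exp (-Real.pi * A x * (n : ℂ) ^ 2
          + 2 * Real.pi * (-Complex.I * r / N) * n)‖ =
        Real.exp (-Real.pi * (A x).re * (n : ℝ) ^ 2) := by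
    intro x r n
    rw [Complex.norm_exp]
    congr 1
    have e : (-Real.pi * A x * (n : ℂ) ^ 2 + 2 * Real.pi * (-Complex.I * r / N) * n : ℂ)
      = ((-Real.pi * (n : ℝ) ^ 2 : ℝ) : ℂ) * A x
        + ((- 2 * Real.pi * r / N * n : ℝ) : ℂ) * Complex.I := by
      push_cast; ring
    rw [e, Complex.add_re, Complex.re_ofReal_mul, Complex.re_ofReal_mul]
    simp only [Complex.I_re]
    ring
  refine tendsto_finsetSum _ fun r _ => ?_
  have key : Filter.Tendsto (fun x => 
        ∑' n : ℤ, Complex.exp (-Real.pi * A x * (n : ℂ) ^ 2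
          + 2 * Real.pi * (-Complex.I * r / N) * n)) Filter.atTop
      (nhds (∑' n : ℤ, if n = 0 then (1 : ℂ) else 0)) := by
    refine tendsto_tsum_of_dominated_convergence
      (bound := fun n : ℤ => ‖Complex.exp (-Real.pi * 1 * (n : ℂ) ^ 2)‖)
      (aux_summable (w := 1) (by simp)) ?_ ?_
    · intro n
      by_cases hn : n = 0
      · simp [hn]
      · simp only [hn, if_false]
        rw [tendsto_zero_iff_norm_tendsto_zero]
        simp only [hnorm]
        refine Real.tendsto_exp_atBot.comp ?_
        have hn2 : (0 : ℝ) < Real.pi * (n : ℝ) ^ 2 := by positivity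
        have := Filter.tendsto_neg_atTop_atBot.comp (hA.const_mul_atTop hn2)
        refine this.congr fun x => ?_
        simp only [Function.comp]
        ring
    · filter_upwards [hA.eventually_ge_atTop 1] with x hx n
      rw [hnorm, Complex.norm_exp]
      apply Real.exp_le_exp.mpr
      have e : (-Real.pi * 1 * (n : ℂ) ^ 2 : ℂ) = ((-Real.pi * (n : ℝ) ^ 2 : ℝ) : ℂ) := by
        push_cast; ring
      rw [e, Complex.ofReal_re]
      have hn2 : (0 : ℝ) ≤ Real.pi * (n : ℝ) ^ 2 := by positivity
      nlinarith
  simpa using key.const_mul (f r)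

lemma aux_limit (N : ℕ) (hN : 0 < N) (f : ℤ → ℂ) (hf : ∀ n, ‖f n‖ ≤ 1)
    (hper : ∀ k r : ℤ, f (k * N + r) = f r) (A : ℝ → ℂ)
    (hA : Filter.Tendsto (fun x => (A x).re) Filter.atTop Filter.atTop) :
    Filter.Tendsto (fun x => 1 / A x ^ (1 / 2 : ℂ) *
      ∑' n : ℤ, f n * Complex.exp (-Real.pi * (1 / (N ^ 2 * A x)) * (n : ℂ) ^ 2)) Filter.atTop
      (nhds (∑ r ∈ range N, f r)) := by
  refine (aux_tendsto N f A hA).congr' ?_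
  filter_upwards [hA.eventually_gt_atTop 0] with x hx
  exact (aux_identity N hN f hf hper hx).symm

lemma aux_main (p m : ℕ) (hp : 0 < p) (hm : 0 < m) :
    (-2 * Complex.I * m / p) ^ (1 / 2 : ℂ) * ∑ j ∈ Finset.range p,
        Complex.exp (2 * Real.pi * Complex.I * (j : ℂ) ^ 2 * (m : ℂ) / p)
      = ∑ j ∈ Finset.range (2 * m),
            Complex.exp (-(Real.pi : ℂ) * Complex.I * (j : ℂ) ^ 2 * (p : ℂ) / (2 * m)) := by
  have hp0 : (p : ℂ) ≠ 0 := by exact_mod_cast hp.ne'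
  have hm0 : (m : ℂ) ≠ 0 := by exact_mod_cast hm.ne'
  have L1 := aux_limit p hp
    (fun n => Complex.exp (2 * Real.pi * Complex.I * (n : ℂ) ^ 2 * (m : ℂ) / p))
    (fun n => by
      have e : (2 * Real.pi * Complex.I * (n : ℂ) ^ 2 * (m : ℂ) / p : ℂ)
        = ((2 * Real.pi * (n : ℝ) ^ 2 * m / p : ℝ) : ℂ) * Complex.I := by push_cast; ring
      rw [e, Complex.norm_exp_ofReal_mul_I])
    (fun k r => by
      rw [Complex.exp_eq_exp_iff_exists_int]
      refine ⟨m * (k ^ 2 * p + 2 * k * r), ?_⟩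
      push_cast
      field_simp
      ring)
    (fun x => (x : ℂ)) (by simpa using! Filter.tendsto_id)
  have L2 := aux_limit (2 * m) (by omega)
    (fun n => Complex.exp (-(Real.pi : ℂ) * Complex.I * (n : ℂ) ^ 2 * (p : ℂ) / (2 * m)))
    (fun n => by
      have e : (-(Real.pi : ℂ) * Complex.I * (n : ℂ) ^ 2 * (p : ℂ) / (2 * m) : ℂ)
        = ((-Real.pi * (n : ℝ) ^ 2 * p / (2 * m) : ℝ) : ℂ) * Complex.I := by push_cast; ring
      rw [e, Complex.norm_exp_ofReal_mul_I])
    (fun k r => by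
      rw [Complex.exp_eq_exp_iff_exists_int]
      refine ⟨-p * (k ^ 2 * m + k * r), ?_⟩
      push_cast
      field_simp
      ring)
    (fun x => (x : ℂ) + ((1 / (2 * m * p) : ℝ) : ℂ) * Complex.I)
    (by
      refine Filter.tendsto_id.congr fun x => ?_
      simp only [Complex.add_re, Complex.re_ofReal_mul, Complex.I_re, Complex.ofReal_re]
      simp)
  have hinv : Filter.Tendsto (fun x : ℝ => ((x⁻¹ : ℝ) : ℂ)) Filter.atTop (nhds 0) := by
    have := (Complex.continuous_ofReal.tendsto 0).comp (tendsto_inv_atTop_zero (𝕜 := ℝ))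
    rw [Complex.ofReal_zero] at this
    exact this
  have La : Filter.Tendsto (fun x : ℝ => ((x⁻¹ : ℝ) / (p : ℂ) ^ 2 + -2 * Complex.I * m / p : ℂ)
      ^ (1 / 2 : ℂ)) Filter.atTop (nhds ((-2 * Complex.I * m / p) ^ (1 / 2 : ℂ))) := by
    have h := (hinv.div_const ((p : ℂ) ^ 2)).add_const (-2 * Complex.I * m / p : ℂ)
    rw [zero_div, zero_add] at h
    refine (continuousAt_cpow_const ?_).tendsto.comp h
    right
    have e : (-2 * Complex.I * m / p : ℂ) = ((-2 * m / p : ℝ) : ℂ) * Complex.I := by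
      push_cast; ring
    rw [e, Complex.im_ofReal_mul, Complex.I_im]
    have : (0:ℝ) < m := by exact_mod_cast hm
    have : (0:ℝ) < p := by exact_mod_cast hp
    rw [mul_one, neg_mul, neg_div]
    exact neg_ne_zero.mpr (by positivity)
  have Lc : Filter.Tendsto (fun x : ℝ =>
      (1 + (x⁻¹ : ℝ) * (((1 / (2 * m * p) : ℝ) : ℂ) * Complex.I) : ℂ)
      ^ (1 / 2 : ℂ)) Filter.atTop (nhds 1) := by
    have h := (hinv.mul_const (((1 / (2 * m * p) : ℝ) : ℂ) * Complex.I)).const_add 1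
    rw [zero_mul, add_zero] at h
    have := (continuousAt_cpow_const (a := 1) (b := (1 / 2 : ℂ)) (by simp)).tendsto.comp h
    simpa using! this
  have T := La.mul L1
  have T2 := Lc.mul L2
  rw [one_mul] at T2
  push_cast at T T2
  refine tendsto_nhds_unique (T.congr' ?_) T2
  filter_upwards [Filter.eventually_gt_atTop 0] with x hx
  have hx0 : (x : ℂ) ≠ 0 := by exact_mod_cast hx.ne'
  set a : ℂ := (x : ℂ)⁻¹ / (p : ℂ) ^ 2 + -2 * Complex.I * m / p with ha
  set B : ℂ := (x : ℂ) + 1 / (2 * m * p) * Complex.I with hB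
  have hare : 0 < a.re := by
    have e : a = ((x⁻¹ / (p : ℝ) ^ 2 : ℝ) : ℂ) + ((-2 * m / p : ℝ) : ℂ) * Complex.I := by
      rw [ha]; push_cast; ring
    rw [e, Complex.add_re, Complex.re_ofReal_mul, Complex.I_re, Complex.ofReal_re]
    have : (0:ℝ) < p := by exact_mod_cast hp
    rw [mul_zero, add_zero]
    positivity
  have hBre : 0 < B.re := by
    have e : B = (x : ℂ) + ((1 / (2 * m * p) : ℝ) : ℂ) * Complex.I := by
      rw [hB]; push_cast; ring
    rw [e, Complex.add_re, Complex.re_ofReal_mul, Complex.I_re, Complex.ofReal_re]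
    simpa using hx
  have ha0 : a ≠ 0 := by rintro h; simp [h] at hare
  have hB0 : B ≠ 0 := by rintro h; simp [h] at hBre
  have hBs : B ^ (1 / 2 : ℂ) = (x : ℂ) ^ (1 / 2 : ℂ) *
      (1 + (x : ℂ)⁻¹ * (1 / (2 * m * p) * Complex.I)) ^ (1 / 2 : ℂ) := by
    have e : B = (x : ℂ) * (1 + (x : ℂ)⁻¹ * (1 / (2 * m * p) * Complex.I)) := by
      rw [hB]; field_simp
    have hne : (1 + (x : ℂ)⁻¹ * (1 / (2 * m * p) * Complex.I)) ≠ 0 := by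
      intro h; rw [h, mul_zero] at e; exact hB0 e
    rw [e, Complex.cpow_def_of_ne_zero (mul_ne_zero hx0 hne), Complex.log_ofReal_mul hx hne,
      add_mul, Complex.exp_add, Complex.cpow_def_of_ne_zero hx0,
      Complex.cpow_def_of_ne_zero hne, Complex.ofReal_log hx.le]
  have S1 : ∑' n : ℤ, Complex.exp (2 * Real.pi * Complex.I * (n : ℂ) ^ 2 * (m : ℂ) / p) *
      Complex.exp (-Real.pi * (1 / (p ^ 2 * x)) * (n : ℂ) ^ 2)
      = ∑' n : ℤ, Complex.exp (-Real.pi * a * (n : ℂ) ^ 2) := by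
    refine tsum_congr fun n => ?_
    rw [← Complex.exp_add]
    congr 1
    rw [ha]
    field_simp
    ring
  have hainv : 1 / a = 1 / ((2 * m) ^ 2 * B) + Complex.I * p / (2 * m) := by
    have h1 : B * (2 * m * p) = 2 * m * p * x + Complex.I := by rw [hB]; field_simp
    have h2 : a * (p ^ 2 * x) = 1 - 2 * Complex.I * m * p * x := by
      rw [ha]; field_simp; ring
    have h3 : a * (p ^ 2 * x) = -Complex.I * (B * (2 * m * p)) := by
      rw [h1, h2]
      linear_combination Complex.I_sq
    have h4 : a * p * x * Complex.I = 2 * m * B := by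
      apply mul_right_cancel₀ hp0
      linear_combination Complex.I * h3 - B * (2 * m * p) * Complex.I_sq
    have h5 : 4 * m ^ 2 * B = a * (1 + 2 * Complex.I * p * m * B) := by
      linear_combination (-2 * m : ℂ) * h4 - a * Complex.I * h1 - a * Complex.I_sq
    field_simp
    linear_combination h5
  have S2 : ∑' n : ℤ, Complex.exp (-(Real.pi : ℂ) * Complex.I * (n : ℂ) ^ 2 * (p : ℂ) / (2 * m)) *
      Complex.exp (-Real.pi * (1 / ((2 * m) ^ 2 * B)) * (n : ℂ) ^ 2)
      = ∑' n : ℤ, Complex.exp (-Real.pi / a * (n : ℂ) ^ 2) := by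
    refine tsum_congr fun n => ?_
    rw [← Complex.exp_add]
    congr 1
    rw [div_eq_mul_one_div (-(Real.pi : ℂ)) a, hainv]
    ring
  rw [S1, S2, Complex.tsum_exp_neg_mul_int_sq hare, hBs]
  have hz : ∀ z : ℂ, z ≠ 0 → z ^ (1 / 2 : ℂ) ≠ 0 := fun z hz => by
    rw [Complex.cpow_def_of_ne_zero hz]; exact Complex.exp_ne_zero _
  have n1 := hz a ha0
  have n2 := hz _ hx0
  have n3 : (1 + (x : ℂ)⁻¹ * (1 / (2 * m * p) * Complex.I)) ^ (1 / 2 : ℂ) ≠ 0 := by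
    intro h; rw [h, mul_zero] at hBs; exact hz B hB0 hBs
  generalize ∑' n : ℤ, Complex.exp (-Real.pi / a * (n : ℂ) ^ 2) = S
  generalize (1 + (x : ℂ)⁻¹ * (1 / (2 * m * p) * Complex.I)) ^ (1 / 2 : ℂ) = u at *
  generalize (x : ℂ) ^ (1 / 2 : ℂ) = v at *
  generalize a ^ (1 / 2 : ℂ) = y at *
  field_simp

theorem stmt4 (p m : ℕ) (hp : 0 < p) (hm : 0 < m) :
    (1 / (Real.sqrt p : ℂ)) * ∑ j ∈ Finset.range p,
        Complex.exp (2 * Real.pi * Complex.I * (j : ℂ) ^ 2 * (m : ℂ) / p)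
      = Complex.exp (Real.pi * Complex.I / 4) / (Real.sqrt (2 * m) : ℂ) *
          ∑ j ∈ Finset.range (2 * m),
            Complex.exp (-(Real.pi : ℂ) * Complex.I * (j : ℂ) ^ 2 * (p : ℂ) / (2 * m)) := by
  have hpr : (0:ℝ) < p := by exact_mod_cast hp
  have hmr : (0:ℝ) < m := by exact_mod_cast hm
  rw [← aux_main p m hp hm]
  have hc : (-2 * Complex.I * m / p : ℂ) ^ (1 / 2 : ℂ)
      = (Real.sqrt (2 * m) : ℂ) / (Real.sqrt p : ℂ) * Complex.exp (-(Real.pi * Complex.I / 4)) := by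
    have e : (-2 * Complex.I * m / p : ℂ) = ((2 * m / p : ℝ) : ℂ) * (-Complex.I) := by
      push_cast; ring
    have hpos : (0:ℝ) < 2 * m / p := by positivity
    have hI : (-Complex.I) ≠ 0 := by simp
    rw [e, Complex.cpow_def_of_ne_zero (mul_ne_zero (by exact_mod_cast hpos.ne') hI),
      Complex.log_ofReal_mul hpos hI, Complex.log_neg_I, add_mul, Complex.exp_add]
    congr 1
    · have : (Real.sqrt (2 * m) : ℂ) / (Real.sqrt p : ℂ) = ((Real.sqrt (2 * m / p) : ℝ) : ℂ) := by
        rw [Real.sqrt_div (by positivity)]; push_cast; rfl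
      rw [this, Real.sqrt_eq_rpow, Real.rpow_def_of_pos hpos]
      push_cast
      rfl
    · congr 1; ring
  rw [hc]
  have h1 : (Real.sqrt (2 * m) : ℂ) ≠ 0 := by
    exact_mod_cast (Real.sqrt_pos.mpr (by positivity : (0:ℝ) < 2 * m)).ne'
  have h2 : (Real.sqrt p : ℂ) ≠ 0 := by
    exact_mod_cast (Real.sqrt_pos.mpr hpr).ne'
  rw [Complex.exp_neg]
  have h3 := Complex.exp_ne_zero (Real.pi * Complex.I / 4)
  generalize ∑ j ∈ Finset.range p,
        Complex.exp (2 * Real.pi * Complex.I * (j : ℂ) ^ 2 * (m : ℂ) / p) = S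
  field_simp
end

section
/- For D ≥ 1 and 0 < t ≤ 1, all Schmidt coefficients of the state |G_{0,0}(t)⟩ = (1/D)∑_{j,k} exp(2πi·jkt/D)|j⟩⊗|k⟩ are strictly positive; i.e., the state has full Schmidt rank D. -/
open Finset Matrix

open scoped ComplexOrder in
theorem eigenvalues_pos_of_isUnit {D : ℕ} (A : Matrix (Fin D) (Fin D) ℂ) (hU : IsUnit A)
    (h : (A * Aᴴ).IsHermitian) : ∀ k : Fin D, 0 < h.eigenvalues k := by
  have hpd : (A * Aᴴ).PosDef :=
    Matrix.PosDef.mul_conjTranspose_self A (Matrix.vecMul_injective_of_isUnit hU)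
  exact fun k => hpd.eigenvalues_pos k

/-- For `0 < t ≤ 1`, all the Schmidt coefficients (eigenvalues of `Ω(t)Ω(t)†`) of the state
`|G_{0,0}(t)⟩ = (1/D) ∑_{j,k} exp(2πi jkt/D) |j⟩⊗|k⟩` are strictly positive, i.e. the state
has full Schmidt rank `D`. -/
theorem stmt13 (D : ℕ) (hD : 1 ≤ D) (t : ℝ) (ht0 : 0 < t) (ht1 : t ≤ 1)
    (Ω : Matrix (Fin D) (Fin D) ℂ)
    (hΩ : Ω = Matrix.of fun j k : Fin D =>
      Complex.exp (2 * Real.pi * Complex.I * (j : ℕ) * (k : ℕ) * (t : ℂ) / D) / D)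
    (h : (Ω * Ωᴴ).IsHermitian) :
    ∀ k : Fin D, 0 < h.eigenvalues k := by
  have hD0 : (D : ℂ) ≠ 0 := by exact_mod_cast (by omega : D ≠ 0)
  have hDpos : (0 : ℝ) < D := by exact_mod_cast hD
  set v : Fin D → ℂ := fun j => Complex.exp (2 * Real.pi * Complex.I * (j : ℕ) * (t : ℂ) / D)
    with hv
  have hinj : Function.Injective v := by
    intro a b hab
    obtain ⟨n, hn⟩ := Complex.exp_eq_exp_iff_exists_int.1 hab
    have h1 : ((a : ℕ) : ℂ) * t = (b : ℕ) * t + n * D := by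
      have h2 : (2 * Real.pi * Complex.I : ℂ) ≠ 0 := Complex.two_pi_I_ne_zero
      field_simp at hn
      apply mul_left_cancel₀ h2
      linear_combination (2 * Real.pi * Complex.I : ℂ) * hn
    have h3 : ((a : ℕ) : ℝ) * t = (b : ℕ) * t + n * D := by exact_mod_cast h1
    have ha : ((a : ℕ) : ℝ) < D := by exact_mod_cast a.2
    have hb : ((b : ℕ) : ℝ) < D := by exact_mod_cast b.2
    have ha0 : (0 : ℝ) ≤ ((a : ℕ) : ℝ) := by positivity
    have hb0 : (0 : ℝ) ≤ ((b : ℕ) : ℝ) := by positivity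
    have hat : ((a : ℕ) : ℝ) * t < D := by nlinarith
    have hbt : ((b : ℕ) : ℝ) * t < D := by nlinarith
    have hat0 : 0 ≤ ((a : ℕ) : ℝ) * t := by positivity
    have hbt0 : 0 ≤ ((b : ℕ) : ℝ) * t := by positivity
    have hn1 : (n : ℝ) < 1 := by
      by_contra hc
      push Not at hc
      nlinarith
    have hn2 : (-1 : ℝ) < n := by
      by_contra hc
      push Not at hc
      nlinarith
    have hn0 : n = 0 := by
      have h4 : n < 1 := by exact_mod_cast hn1
      have h5 : -1 < n := by exact_mod_cast hn2
      omega
    subst hn0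
    have h6 : ((a : ℕ) : ℝ) = (b : ℕ) := by
      apply mul_right_cancel₀ ht0.ne'
      simpa using h3
    exact Fin.ext (by exact_mod_cast h6)
  have hdet : Ω.det ≠ 0 := by
    have hΩ' : Ω = (D : ℂ)⁻¹ • Matrix.vandermonde v := by
      rw [hΩ]
      ext j k
      simp only [Matrix.of_apply, Matrix.smul_apply, Matrix.vandermonde_apply, hv, smul_eq_mul]
      rw [← Complex.exp_nat_mul, div_eq_inv_mul]
      congr 2
      ring
    rw [hΩ', Matrix.det_smul]
    exact mul_ne_zero (pow_ne_zero _ (inv_ne_zero hD0))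
      (Matrix.det_vandermonde_ne_zero_iff.2 hinj)
  have hU : IsUnit Ω := (Matrix.isUnit_iff_isUnit_det Ω).2 hdet.isUnit
  exact eigenvalues_pos_of_isUnit Ω hU h
end
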